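/- There is no voting method whose domain is the set of all profiles with at most 6 candidates that satisfies anonymity, neutrality, binary quasi-resoluteness, binary γ, and α-resoluteness. -/

import Mathlib

/- Formalization of voting-theoretic notions from Holliday, Norman, Pacuit, Zahedian,
"Impossibility theorems involving weakenings of expansion consistency and resoluteness
in voting". Candidates form an infinite type `C` and voters an infinite type `V`. -/

open Classical

noncomputable section

/-- `L` is a strict linear order on exactly the finite set `s`. -/
def IsStrictLinearOrderOn {C : Type} (s : Finset C) (L : C → C → Prop) : Prop :=
  (∀ x, ¬ L x x) ∧ (∀ x y z, L x y → L y z → L x z) ∧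
    (∀ x ∈ s, ∀ y ∈ s, x ≠ y → L x y ∨ L y x) ∧ ∀ x y, L x y → x ∈ s ∧ y ∈ s

/-- Restriction of a relation to a finite set `A`. -/
def restrictRel {C : Type} (A : Finset C) (L : C → C → Prop) : C → C → Prop :=
  fun x y => L x y ∧ x ∈ A ∧ y ∈ A

theorem IsStrictLinearOrderOn.restrict {C : Type} {s A : Finset C} {L : C → C → Prop}
    (h : IsStrictLinearOrderOn s L) (hA : A ⊆ s) :
    IsStrictLinearOrderOn A (restrictRel A L) := by
  obtain ⟨hirr, htr, htot, hdom⟩ := h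
  refine ⟨fun x hx => hirr x hx.1,
    fun x y z hxy hyz => ⟨htr _ _ _ hxy.1 hyz.1, hxy.2.1, hyz.2.2⟩, ?_,
    fun x y hxy => ⟨hxy.2.1, hxy.2.2⟩⟩
  intro x hx y hy hne
  rcases htot x (hA hx) y (hA hy) hne with h' | h'
  · exact Or.inl ⟨h', hx, hy⟩
  · exact Or.inr ⟨h', hy, hx⟩

/-- The image of a relation under the transposition of `a` and `b`. -/
def swapRel {C : Type} (a b : C) (L : C → C → Prop) : C → C → Prop :=
  fun x y => L (Equiv.swap a b x) (Equiv.swap a b y)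

theorem IsStrictLinearOrderOn.swapRel_mem {C : Type} {s : Finset C} {L : C → C → Prop}
    (a b : C) (h : IsStrictLinearOrderOn s L) :
    IsStrictLinearOrderOn (s.image (Equiv.swap a b)) (swapRel a b L) := by
  obtain ⟨hirr, htr, htot, hdom⟩ := h
  refine ⟨fun x => hirr _, fun x y z hxy hyz => htr _ _ _ hxy hyz, ?_, ?_⟩
  · intro x hx y hy hne
    obtain ⟨x', hx', rfl⟩ := Finset.mem_image.mp hx
    obtain ⟨y', hy', rfl⟩ := Finset.mem_image.mp hy
    have hne' : x' ≠ y' := by rintro rfl; exact hne rfl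
    have := htot x' hx' y' hy' hne'
    simpa [swapRel, Equiv.swap_apply_self] using this
  · intro x y hxy
    obtain ⟨h1, h2⟩ := hdom _ _ hxy
    exact ⟨Finset.mem_image.mpr ⟨_, h1, Equiv.swap_apply_self a b x⟩,
      Finset.mem_image.mpr ⟨_, h2, Equiv.swap_apply_self a b y⟩⟩

/-- A preference profile: each voter in the finite set `voters` submits a strict linear
order of the finite nonempty set `cands` of candidates. -/
structure Profile (C V : Type) where
  voters : Finset V
  cands : Finset C
  cands_nonempty : cands.Nonempty
  ballot : V → C → C → Prop
  ballot_lin : ∀ i ∈ voters, IsStrictLinearOrderOn cands (ballot i)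

namespace Profile

variable {C V : Type}

/-- The margin of `x` over `y` in `P`: the number of voters ranking `x` above `y`
minus the number of voters ranking `y` above `x`. -/
def margin (P : Profile C V) (x y : C) : ℤ :=
  ((P.voters.filter (fun i => P.ballot i x y)).card : ℤ) -
    ((P.voters.filter (fun i => P.ballot i y x)).card : ℤ)

/-- The profile `P^{i⇄j}` obtained by transposing the voters `i` and `j`. -/
def swapVoters (P : Profile C V) (i j : V) : Profile C V where
  voters := P.voters.image (Equiv.swap i j)
  cands := P.cands
  cands_nonempty := P.cands_nonempty
  ballot := fun k => P.ballot (Equiv.swap i j k)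
  ballot_lin := by
    intro k hk
    obtain ⟨m, hm, rfl⟩ := Finset.mem_image.mp hk
    simpa [Equiv.swap_apply_self] using P.ballot_lin m hm

/-- The profile `P_{a⇄b}` obtained by transposing the candidates `a` and `b`. -/
def swapCands (P : Profile C V) (a b : C) : Profile C V where
  voters := P.voters
  cands := P.cands.image (Equiv.swap a b)
  cands_nonempty := P.cands_nonempty.image _
  ballot := fun i => swapRel a b (P.ballot i)
  ballot_lin := fun i hi => (P.ballot_lin i hi).swapRel_mem a b

/-- The restriction `P|_A` of a profile to a nonempty subset `A` of its candidates. -/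
def restrict (P : Profile C V) (A : Finset C) (hA : A.Nonempty) (hsub : A ⊆ P.cands) :
    Profile C V where
  voters := P.voters
  cands := A
  cands_nonempty := hA
  ballot := fun i => restrictRel A (P.ballot i)
  ballot_lin := fun i hi => (P.ballot_lin i hi).restrict hsub

/-- The profile `P_{-y}`, i.e. `P` with the candidate `y` removed. -/
def minus (P : Profile C V) (y : C) (h : (P.cands.erase y).Nonempty) : Profile C V :=
  P.restrict (P.cands.erase y) h (P.cands.erase_subset y)

/-- The profile `P|_{{x,y}}`, i.e. `P` restricted to the two candidates `x` and `y`. -/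
def pair (P : Profile C V) (x y : C) (hx : x ∈ P.cands) (hy : y ∈ P.cands) : Profile C V :=
  P.restrict {x, y} ⟨x, Finset.mem_insert_self x {y}⟩
    (by
      intro z hz
      rcases Finset.mem_insert.mp hz with rfl | hz
      · exact hx
      · rcases Finset.mem_singleton.mp hz with rfl
        exact hy)

/-- `P` is uniquely weighted: no two distinct ordered pairs of distinct candidates
have the same margin. -/
def UniquelyWeighted (P : Profile C V) : Prop :=
  ∀ a ∈ P.cands, ∀ b ∈ P.cands, ∀ x ∈ P.cands, ∀ y ∈ P.cands,
    a ≠ b → x ≠ y → (a, b) ≠ (x, y) → P.margin a b ≠ P.margin x y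

/-- `P` is uniquely ranked: in every subelection with at least two candidates, no two
candidates have the same number of `n`-th place votes, and no two candidates have the
same Borda score. -/
def UniquelyRanked (P : Profile C V) : Prop :=
  ∀ Y ⊆ P.cands, 2 ≤ Y.card →
    ((∀ n : ℕ, 1 ≤ n → n ≤ Y.card → ∀ x ∈ Y, ∀ y ∈ Y, x ≠ y →
        (P.voters.filter
            (fun i => (Y.filter (fun z => P.ballot i z x)).card = n - 1)).card ≠
          (P.voters.filter
            (fun i => (Y.filter (fun z => P.ballot i z y)).card = n - 1)).card) ∧
      (∀ x ∈ Y, ∀ y ∈ Y, x ≠ y →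
        (∑ i ∈ P.voters, (Y.filter (fun z => P.ballot i x z)).card) ≠
          ∑ i ∈ P.voters, (Y.filter (fun z => P.ballot i y z)).card))

/-- `Q` is an `n`-fold copy `nP` of `P`: same candidates, and there is a map sending
the voters of `Q` onto the voters of `P` such that each voter of `P` has exactly `n`
preimages, each with the same ballot. -/
def IsCopy (Q P : Profile C V) (n : ℕ) : Prop :=
  Q.cands = P.cands ∧
    ∃ h : V → V,
      (∀ j ∈ Q.voters, h j ∈ P.voters) ∧
      (∀ i ∈ P.voters, (Q.voters.filter (fun j => h j = i)).card = n) ∧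
      (∀ j ∈ Q.voters, Q.ballot j = P.ballot (h j))

/-- `Q` is obtained from `P` by deleting one voter with each linear order of the
candidates of `P`. -/
def IsCancelOf (Q P : Profile C V) : Prop :=
  Q.cands = P.cands ∧ Q.voters ⊆ P.voters ∧
    (∀ j ∈ Q.voters, Q.ballot j = P.ballot j) ∧
    ∀ L : C → C → Prop, IsStrictLinearOrderOn P.cands L →
      ((P.voters \ Q.voters).filter (fun i => P.ballot i = L)).card = 1

end Profile

/-- A voting method: a function assigning to each profile in a nonempty domain a
nonempty set of winners among its candidates. -/
structure VotingMethod (C V : Type) where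
  dom : Set (Profile C V)
  dom_nonempty : dom.Nonempty
  winners : Profile C V → Finset C
  winners_nonempty : ∀ P ∈ dom, (winners P).Nonempty
  winners_sub : ∀ P ∈ dom, winners P ⊆ P.cands

namespace VotingMethod

variable {C V : Type}

/-- Anonymity: transposing two voters does not change the winners. -/
def Anonymous (F : VotingMethod C V) : Prop :=
  ∀ P ∈ F.dom, ∀ i j : V, P.swapVoters i j ∈ F.dom →
    F.winners (P.swapVoters i j) = F.winners P

/-- Neutrality: transposing two candidates transposes the winners accordingly. -/
def Neutral (F : VotingMethod C V) : Prop :=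
  ∀ P ∈ F.dom, ∀ a b : C, P.swapCands a b ∈ F.dom →
    F.winners (P.swapCands a b) = (F.winners P).image (Equiv.swap a b)

/-- Binary resoluteness: a unique winner in any two-candidate profile. -/
def BinaryResolute (F : VotingMethod C V) : Prop :=
  ∀ P ∈ F.dom, P.cands.card = 2 → (F.winners P).card = 1

/-- Binary quasi-resoluteness: a unique winner in any two-candidate profile whose
two distinct candidates have a nonzero margin between them. -/
def BinaryQuasiResolute (F : VotingMethod C V) : Prop :=
  ∀ P ∈ F.dom, P.cands.card = 2 →
    (∀ x ∈ P.cands, ∀ y ∈ P.cands, x ≠ y → P.margin x y ≠ 0) →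
    (F.winners P).card = 1

/-- Quasi-resoluteness: a unique winner in any uniquely weighted profile. -/
def QuasiResolute (F : VotingMethod C V) : Prop :=
  ∀ P ∈ F.dom, P.UniquelyWeighted → (F.winners P).card = 1

/-- Weak quasi-resoluteness: a unique winner in any profile that is both uniquely
weighted and uniquely ranked. -/
def WeakQuasiResolute (F : VotingMethod C V) : Prop :=
  ∀ P ∈ F.dom, P.UniquelyWeighted → P.UniquelyRanked → (F.winners P).card = 1

/-- Binary γ: if `x` wins without `y` and wins the head-to-head against `y`,
then `x` wins with `y` included. -/
def BinaryGamma (F : VotingMethod C V) : Prop :=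
  ∀ P ∈ F.dom, ∀ x, ∀ hx : x ∈ P.cands, ∀ y, ∀ hy : y ∈ P.cands, x ≠ y →
    ∀ h : (P.cands.erase y).Nonempty,
      P.minus y h ∈ F.dom → P.pair x y hx hy ∈ F.dom →
      x ∈ F.winners (P.minus y h) → F.winners (P.pair x y hx hy) = {x} →
      x ∈ F.winners P

/-- α-resoluteness: if `x` wins without `y` and wins the head-to-head against `y`,
then adding `y` does not enlarge the set of winners. -/
def AlphaResolute (F : VotingMethod C V) : Prop :=
  ∀ P ∈ F.dom, ∀ x, ∀ hx : x ∈ P.cands, ∀ y, ∀ hy : y ∈ P.cands, x ≠ y →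
    ∀ h : (P.cands.erase y).Nonempty,
      P.minus y h ∈ F.dom → P.pair x y hx hy ∈ F.dom →
      x ∈ F.winners (P.minus y h) → F.winners (P.pair x y hx hy) = {x} →
      (F.winners P).card ≤ (F.winners (P.minus y h)).card

/-- Homogeneity: replacing each voter by `n` copies of that voter does not change
the winners. -/
def Homogeneous (F : VotingMethod C V) : Prop :=
  ∀ P ∈ F.dom, ∀ Q ∈ F.dom, ∀ n : ℕ, 0 < n → Q.IsCopy P n → F.winners Q = F.winners P

/-- Cancellativity: deleting one voter with each linear order of the candidates does
not change the winners. -/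
def Cancellative (F : VotingMethod C V) : Prop :=
  ∀ P ∈ F.dom, ∀ Q ∈ F.dom, Q.IsCancelOf P → F.winners Q = F.winners P

/-- Majoritarianism: the winners depend only on the majority graph of the profile. -/
def Majoritarian (F : VotingMethod C V) : Prop :=
  ∀ P ∈ F.dom, ∀ P' ∈ F.dom, P.cands = P'.cands →
    (∀ x ∈ P.cands, ∀ y ∈ P.cands, (0 < P.margin x y ↔ 0 < P'.margin x y)) →
    F.winners P = F.winners P'

/-- Pairwiseness: the winners depend only on the margin graph of the profile. -/
def Pairwise (F : VotingMethod C V) : Prop :=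
  ∀ P ∈ F.dom, ∀ P' ∈ F.dom, P.cands = P'.cands →
    (∀ x ∈ P.cands, ∀ y ∈ P.cands, P.margin x y = P'.margin x y) →
    F.winners P = F.winners P'

end VotingMethod

/-! ### A combinatorial core about tournaments on six vertices -/

namespace SixCand

/-- A boolean matrix is a tournament. -/
def IsT (T : Fin 6 → Fin 6 → Bool) : Prop := ∀ p q, T p q = (decide (p ≠ q) && !T q p)

instance (T : Fin 6 → Fin 6 → Bool) : Decidable (IsT T) := by unfold IsT; infer_instance

def TA : Fin 6 → Fin 6 → Bool := fun i j =>
  decide ((i, j) ∈ ([(0,1),(0,2),(0,3),(0,4),(1,2),(1,3),(1,4),(1,5),(2,3),(2,5),(3,4),(3,5),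
    (4,2),(4,5),(5,0)] : List (Fin 6 × Fin 6)))

def TB : Fin 6 → Fin 6 → Bool := fun i j =>
  decide ((i, j) ∈ ([(0,1),(0,2),(0,3),(1,2),(1,3),(1,4),(2,3),(2,5),(3,4),(3,5),
    (4,0),(4,2),(4,5),(5,0),(5,1)] : List (Fin 6 × Fin 6)))

theorem isT_TA : IsT TA := by decide
theorem isT_TB : IsT TB := by decide

open Equiv in
theorem core (f : (Fin 6 → Fin 6 → Bool) → Finset (Fin 6) → Finset (Fin 6))
    (sub : ∀ T A, IsT T → A.Nonempty → f T A ⊆ A)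
    (ne : ∀ T A, IsT T → A.Nonempty → (f T A).Nonempty)
    (tr : ∀ T T' A (π : Perm (Fin 6)), IsT T → IsT T' → A.Nonempty →
      (∀ x ∈ A, ∀ y ∈ A, T' (π x) (π y) = T x y) → f T' (A.image π) = (f T A).image π)
    (ga : ∀ T A x y, IsT T → x ∈ A → y ∈ A → x ≠ y → T x y = true → x ∈ f T (A.erase y) →
      x ∈ f T A ∧ (f T A).card ≤ (f T (A.erase y)).card) : False := by
  have tr' : ∀ T T' (A B : Finset (Fin 6)) (π : Perm (Fin 6)), IsT T → IsT T' → A.Nonempty →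
      (∀ x ∈ A, ∀ y ∈ A, T' (π x) (π y) = T x y) → A.image π = B →
      f T' B = (f T A).image π := by
    intro T T' A B π h1 h2 h3 h4 h5
    rw [← h5]; exact tr T T' A π h1 h2 h3 h4
  have ga' : ∀ T A B x y, IsT T → x ∈ A → y ∈ A → x ≠ y → T x y = true → A.erase y = B →
      x ∈ f T B → x ∈ f T A ∧ (f T A).card ≤ (f T B).card := by
    intro T A B x y h1 h2 h3 h4 h5 h6 h7
    subst h6; exact ga T A x y h1 h2 h3 h4 h5 h7
  have c1 : f TB {0,1,4} = {0,1,4} := by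
    have h1 := tr' TB TB {0,1,4} {0,1,4} (swap 0 1 * swap 1 4) isT_TB isT_TB (by decide)
      (by decide) (by decide)
    have h2 := sub TB {0,1,4} isT_TB (by decide)
    have h3 := ne TB {0,1,4} isT_TB (by decide)
    generalize f TB {0,1,4} = S at h1 h2 h3 ⊢
    revert S; decide
  have c2 : f TB {0,3,4} = {0,3,4} := by
    rw [tr' TB TB {0,1,4} {0,3,4} (swap 1 3) isT_TB isT_TB (by decide) (by decide) (by decide), c1]
    decide
  have r5 : f TB {0,1,3,4,5} = {0,1,3,4,5} := by
    have h1 := tr' TB TB {0,1,3,4,5} {0,1,3,4,5} (swap 0 1 * swap 1 3 * swap 3 4 * swap 4 5)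
      isT_TB isT_TB (by decide) (by decide) (by decide)
    have h2 := sub TB {0,1,3,4,5} isT_TB (by decide)
    have h3 := ne TB {0,1,3,4,5} isT_TB (by decide)
    generalize f TB {0,1,3,4,5} = S at h1 h2 h3 ⊢
    revert S; decide
  have s4 : f TB {0,1,3,4} = {0,1} := by
    have h1 := ga' TB {0,1,3,4} {0,1,4} 0 3 isT_TB (by decide) (by decide) (by decide) (by decide)
      (by decide) (by rw [c1]; decide)
    have h2 := ga' TB {0,1,3,4} {0,1,4} 1 3 isT_TB (by decide) (by decide) (by decide) (by decide)
      (by decide) (by rw [c1]; decide)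
    have h3 := ga' TB {0,1,3,4,5} {0,1,3,4} 3 5 isT_TB (by decide) (by decide) (by decide)
      (by decide) (by decide)
    have h4 := ga' TB {0,1,3,4,5} {0,1,3,4} 4 5 isT_TB (by decide) (by decide) (by decide)
      (by decide) (by decide)
    have h5 := sub TB {0,1,3,4} isT_TB (by decide)
    rw [r5] at h3 h4
    rw [c1] at h1 h2
    have e5 : ({0,1,3,4,5} : Finset (Fin 6)).card = 5 := by decide
    have e3 : ({0,1,4} : Finset (Fin 6)).card = 3 := by decide
    have n3 : 3 ∉ f TB {0,1,3,4} := fun h => by have := (h3 h).2; omega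
    have n4 : 4 ∉ f TB {0,1,3,4} := fun h => by have := (h4 h).2; omega
    have p0 := h1.1
    have p1 := h2.1
    clear h1 h2 h3 h4
    generalize f TB {0,1,3,4} = S at *
    revert S; decide
  have a1 : f TA {0,3,4,5} = {0,3} := by
    rw [tr' TB TA {0,1,3,4} {0,3,4,5} (swap 1 3 * swap 3 4 * swap 4 5) isT_TB isT_TA
      (by decide) (by decide) (by decide), s4]
    decide
  have a2 : f TA {0,1,4,5} = {0,1} := by
    rw [tr' TB TA {0,1,3,4} {0,1,4,5} (swap 3 4 * swap 4 5) isT_TB isT_TA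
      (by decide) (by decide) (by decide), s4]
    decide
  have a3 : f TA {0,2,3,4,5} = {0} ∨ f TA {0,2,3,4,5} = {0,5} := by
    have h1 := ga' TA {0,2,3,4,5} {0,3,4,5} 0 2 isT_TA (by decide) (by decide) (by decide)
      (by decide) (by decide) (by rw [a1]; decide)
    have h2 := tr' TA TA {0,2,3,4,5} {0,2,3,4,5} (swap 2 3 * swap 3 4)
      isT_TA isT_TA (by decide) (by decide) (by decide)
    have h3 := sub TA {0,2,3,4,5} isT_TA (by decide)
    rw [a1] at h1
    generalize f TA {0,2,3,4,5} = S at h1 h2 h3 ⊢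
    revert S; decide
  have a4 : f TA {0,1,3,4,5} = {0,1} := by
    have h1 := ga' TA {0,1,3,4,5} {0,1,4,5} 0 3 isT_TA (by decide) (by decide) (by decide)
      (by decide) (by decide) (by rw [a2]; decide)
    have h2 := ga' TA {0,1,3,4,5} {0,1,4,5} 1 3 isT_TA (by decide) (by decide) (by decide)
      (by decide) (by decide) (by rw [a2]; decide)
    rw [a2] at h1 h2
    generalize f TA {0,1,3,4,5} = S at h1 h2 ⊢
    revert S; decide
  have a5 : f TA {0,2,3,4,5} = {0,5} := by
    rcases a3 with h | h
    · exfalso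
      have h1 := ga' TA {0,1,2,3,4,5} {0,1,3,4,5} 0 2 isT_TA (by decide) (by decide) (by decide)
        (by decide) (by decide) (by rw [a4]; decide)
      have h2 := ga' TA {0,1,2,3,4,5} {0,1,3,4,5} 1 2 isT_TA (by decide) (by decide) (by decide)
        (by decide) (by decide) (by rw [a4]; decide)
      have h3 := ga' TA {0,1,2,3,4,5} {0,2,3,4,5} 0 1 isT_TA (by decide) (by decide) (by decide)
        (by decide) (by decide) (by rw [h]; decide)
      rw [h] at h3
      have p0 := h1.1
      have p1 := h2.1
      have h4 := h3.2
      rw [Finset.card_singleton, Finset.card_le_one] at h4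
      exact absurd (h4 _ p0 _ p1) (by decide)
    · exact h
  have b1 : f TB {1,2,3,4,5} = {1,5} := by
    rw [tr' TA TB {0,2,3,4,5} {1,2,3,4,5} (swap 0 1) isT_TA isT_TB
      (by decide) (by decide) (by decide), a5]
    decide
  have h1 := ga' TB {0,1,2,3,4,5} {1,2,3,4,5} 5 0 isT_TB (by decide) (by decide) (by decide)
    (by decide) (by decide) (by rw [b1]; decide)
  have h2 := ga' TB {0,1,2,3,4,5} {0,1,3,4,5} 0 2 isT_TB (by decide) (by decide) (by decide)
    (by decide) (by decide) (by rw [r5]; decide)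
  have h3 := ga' TB {0,1,2,3,4,5} {0,1,3,4,5} 1 2 isT_TB (by decide) (by decide) (by decide)
    (by decide) (by decide) (by rw [r5]; decide)
  have h4 := h1.2
  rw [b1] at h4
  have h5 : ({0, 1, 5} : Finset (Fin 6)) ⊆ f TB {0,1,2,3,4,5} := by
    intro x hx
    simp only [Finset.mem_insert, Finset.mem_singleton] at hx
    rcases hx with rfl | rfl | rfl
    exacts [h2.1, h3.1, h1.1]
  have h6 := Finset.card_le_card h5
  have e3 : ({0,1,5} : Finset (Fin 6)).card = 3 := by decide
  have e2 : ({1,5} : Finset (Fin 6)).card = 2 := by decide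
  omega

/-! ### The canonical profiles of a tournament -/

abbrev Idx := Equiv.Perm (Fin 6) × Bool

theorem exists_all (α : Type) [Finite α] : ∃ S : Finset α, ∀ i, i ∈ S :=
  ⟨(Set.finite_univ (α := α)).toFinset, fun i => by simp⟩

/-- All voter indices, kept opaque to unification. -/
def UI : Finset Idx := Classical.choose (exists_all Idx)

theorem mem_UI (i : Idx) : i ∈ UI := Classical.choose_spec (exists_all Idx) i

theorem IsT.irr {T} (hT : IsT T) (x : Fin 6) : T x x = false := by simpa using hT x x

theorem IsT.asymm {T} (hT : IsT T) {x y : Fin 6} (h : T x y = true) : T y x = false := by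
  have := hT x y
  rw [h] at this
  simp at this
  exact this.2

theorem IsT.ne {T} (hT : IsT T) {x y : Fin 6} (h : T x y = true) : x ≠ y := by
  rintro rfl
  rw [hT.irr] at h
  exact Bool.noConfusion h

/-- The ballot of voter `(σ, b)`: rank by `σ` (or in reverse), except that the two
candidates in positions `0, 1` are compared according to `T`. -/
def bal (T : Fin 6 → Fin 6 → Bool) (i : Idx) (p q : Fin 6) : Prop :=
  if i.1 p < 2 ∧ i.1 q < 2 then T p q = true else
    if i.2 = true then i.1 p < i.1 q else i.1 q < i.1 p

theorem bal_irrefl {T} (hT : IsT T) (i : Idx) (p : Fin 6) : ¬ bal T i p p := by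
  have := hT p p
  unfold bal
  split_ifs <;> simp_all

theorem bal_total {T} (hT : IsT T) (i : Idx) (p q : Fin 6) (h : p ≠ q) :
    bal T i p q ∨ bal T i q p := by
  have h1 := hT p q
  have h2 : i.1 p ≠ i.1 q := fun h' => h (i.1.injective h')
  unfold bal
  by_cases hp : i.1 p < 2 ∧ i.1 q < 2
  · have hq : i.1 q < 2 ∧ i.1 p < 2 := hp.symm
    rw [if_pos hp, if_pos hq]
    cases hh : T q p <;> simp_all
  · have hq : ¬ (i.1 q < 2 ∧ i.1 p < 2) := fun h => hp h.symm
    rw [if_neg hp, if_neg hq]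
    split_ifs
    · exact lt_or_gt_of_ne h2
    · exact (lt_or_gt_of_ne h2).symm

theorem bal_trans {T} (hT : IsT T) (i : Idx) (p q r : Fin 6)
    (h1 : bal T i p q) (h2 : bal T i q r) : bal T i p r := by
  obtain ⟨σ, b⟩ := i
  have key : σ p < 2 → σ q < 2 → σ r < 2 → p = q ∨ q = r ∨ p = r := by
    intro a1 a2 a3
    have : σ p = σ q ∨ σ q = σ r ∨ σ p = σ r := by omega
    simpa using this
  have d1 : ∀ x, T x x = false := fun x => by simpa using hT x x
  have d2 : ∀ x y, T x y = true → T y x = true → False := fun x y h h' => by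
    have := hT x y
    simp_all
  unfold bal at *
  simp only at *
  by_cases a1 : σ p < 2 <;> by_cases a2 : σ q < 2 <;> by_cases a3 : σ r < 2 <;>
    cases b <;> simp only [a1, a2, a3, true_and, and_true, false_and, and_false, if_true,
      if_false, and_self, Bool.false_eq_true] at h1 h2 ⊢ <;> first
    | omega
    | exact h1
    | exact h2
    | (rcases key a1 a2 a3 with rfl | rfl | rfl
       · simp_all
       · simp_all
       · exact (d2 _ _ h1 h2).elim)

section
variable {C V : Type} (ev : Idx ↪ V) (ec : Fin 6 ↪ C)

/-- The profile with candidates `A` and ballots given by `b`. -/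
def mkP (A : Finset (Fin 6)) (hA : A.Nonempty) (b : Idx → Fin 6 → Fin 6 → Prop)
    (h0 : ∀ i p, ¬ b i p p) (h1 : ∀ i p q r, b i p q → b i q r → b i p r)
    (h2 : ∀ i p q, p ≠ q → b i p q ∨ b i q p) : Profile C V where
  voters := UI.map ev
  cands := A.map ec
  cands_nonempty := hA.map
  ballot := fun v x y => ∃ i p q, ev i = v ∧ ec p = x ∧ ec q = y ∧ p ∈ A ∧ q ∈ A ∧ b i p q
  ballot_lin := by
    intro v hv
    obtain ⟨i, -, rfl⟩ := Finset.mem_map.mp hv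
    refine ⟨?_, ?_, ?_, ?_⟩
    · rintro x ⟨j, p, q, -, rfl, h, -, -, hb⟩
      rw [ec.injective h] at hb
      exact h0 _ _ hb
    · rintro x y z ⟨j, p, q, hj, rfl, rfl, hp, hq, hb⟩ ⟨j', p', q', hj', hh, rfl, hp', hq', hb'⟩
      rw [ec.injective hh] at hb'
      rw [ev.injective hj] at hb
      rw [ev.injective hj'] at hb'
      exact ⟨i, p, q', rfl, rfl, rfl, hp, hq', h1 _ _ _ _ hb hb'⟩
    · intro x hx y hy hne
      obtain ⟨p, hp, rfl⟩ := Finset.mem_map.mp hx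
      obtain ⟨q, hq, rfl⟩ := Finset.mem_map.mp hy
      rcases h2 i p q (fun h => hne (by rw [h])) with h | h
      · exact Or.inl ⟨i, p, q, rfl, rfl, rfl, hp, hq, h⟩
      · exact Or.inr ⟨i, q, p, rfl, rfl, rfl, hq, hp, h⟩
    · rintro x y ⟨j, p, q, hj, rfl, rfl, hp, hq, hb⟩
      exact ⟨Finset.mem_map_of_mem _ hp, Finset.mem_map_of_mem _ hq⟩

theorem prof_ext {P Q : Profile C V} (h1 : P.voters = Q.voters) (h2 : P.cands = Q.cands)
    (h3 : ∀ v x y, P.ballot v x y ↔ Q.ballot v x y) : P = Q := by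
  obtain ⟨a, b, c, d, e⟩ := P
  obtain ⟨a', b', c', d', e'⟩ := Q
  simp only at h1 h2 h3
  subst h1 h2
  have : d = d' := by funext v x y; exact propext (h3 v x y)
  subst this
  rfl

theorem mkP_congr {A A' : Finset (Fin 6)} {hA hA'} {b b' h0 h1 h2 h0' h1' h2'} (e : A = A')
    (h : ∀ i, ∀ p ∈ A, ∀ q ∈ A, (b i p q ↔ b' i p q)) :
    mkP ev ec A hA b h0 h1 h2 = mkP ev ec A' hA' b' h0' h1' h2' := by
  subst e
  refine prof_ext rfl rfl ?_
  intro v x y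
  constructor
  · rintro ⟨i, p, q, e1, e2, e3, hp, hq, hb⟩
    exact ⟨i, p, q, e1, e2, e3, hp, hq, (h i p hp q hq).1 hb⟩
  · rintro ⟨i, p, q, e1, e2, e3, hp, hq, hb⟩
    exact ⟨i, p, q, e1, e2, e3, hp, hq, (h i p hp q hq).2 hb⟩

theorem mkP_restrict {A B : Finset (Fin 6)} {hA hB} {b h0 h1 h2} (hBA : B ⊆ A) (S : Finset C)
    (hS : S = B.map ec) (hne hsub) :
    (mkP ev ec A hA b h0 h1 h2).restrict S hne hsub = mkP ev ec B hB b h0 h1 h2 := by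
  subst hS
  refine prof_ext rfl rfl ?_
  intro v x y
  constructor
  · rintro ⟨⟨i, p, q, e1, rfl, rfl, hp, hq, hb⟩, hx, hy⟩
    exact ⟨i, p, q, e1, rfl, rfl, (Finset.mem_map' _).1 hx, (Finset.mem_map' _).1 hy, hb⟩
  · rintro ⟨i, p, q, e1, rfl, rfl, hp, hq, hb⟩
    exact ⟨⟨i, p, q, e1, rfl, rfl, hBA hp, hBA hq, hb⟩, Finset.mem_map_of_mem _ hp,
      Finset.mem_map_of_mem _ hq⟩

theorem mkP_swapVoters {A : Finset (Fin 6)} {hA} {b h0 h1 h2} (i j : Idx) :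
    (mkP ev ec A hA b h0 h1 h2).swapVoters (ev i) (ev j) =
      mkP ev ec A hA (fun k => b (Equiv.swap i j k)) (fun k => h0 _) (fun k => h1 _)
        (fun k => h2 _) := by
  refine prof_ext ?_ rfl ?_
  · ext v
    simp only [Profile.swapVoters, mkP, Finset.mem_image, Finset.mem_map, mem_UI, true_and]
    constructor
    · rintro ⟨_, ⟨k, rfl⟩, rfl⟩
      exact ⟨Equiv.swap i j k, ev.injective.map_swap _ _ _⟩
    · rintro ⟨k, rfl⟩
      refine ⟨_, ⟨Equiv.swap i j k, rfl⟩, ?_⟩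
      rw [← ev.injective.map_swap, Equiv.swap_apply_self]
  · intro v x y
    constructor
    · rintro ⟨k, p, q, e1, rfl, rfl, hp, hq, hb⟩
      refine ⟨Equiv.swap i j k, p, q, ?_, rfl, rfl, hp, hq, ?_⟩
      · rw [ev.injective.map_swap, e1, Equiv.swap_apply_self]
      · simpa using hb
    · rintro ⟨k, p, q, rfl, rfl, rfl, hp, hq, hb⟩
      exact ⟨Equiv.swap i j k, p, q, ev.injective.map_swap _ _ _, rfl, rfl, hp, hq, hb⟩

theorem mkP_swapCands {A : Finset (Fin 6)} {hA} {b h0 h1 h2} (i j : Fin 6) :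
    (mkP ev ec A hA b h0 h1 h2).swapCands (ec i) (ec j) =
      mkP ev ec (A.image (Equiv.swap i j)) (hA.image _)
        (fun k p q => b k (Equiv.swap i j p) (Equiv.swap i j q)) (fun k p => h0 _ _)
        (fun k p q r => h1 _ _ _ _)
        (fun k p q h => h2 _ _ _ (fun h' => h ((Equiv.swap i j).injective h'))) := by
  refine prof_ext rfl ?_ ?_
  · ext v
    simp only [Profile.swapCands, mkP, Finset.mem_image, Finset.mem_map]
    constructor
    · rintro ⟨_, ⟨k, hk, rfl⟩, rfl⟩
      exact ⟨Equiv.swap i j k, ⟨k, hk, rfl⟩, ec.injective.map_swap _ _ _⟩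
    · rintro ⟨_, ⟨k, hk, rfl⟩, rfl⟩
      exact ⟨_, ⟨k, hk, rfl⟩, (ec.injective.map_swap _ _ _).symm⟩
  · intro v x y
    constructor
    · rintro ⟨k, p, q, e1, e2, e3, hp, hq, hb⟩
      refine ⟨k, Equiv.swap i j p, Equiv.swap i j q, e1, ?_, ?_, Finset.mem_image_of_mem _ hp,
        Finset.mem_image_of_mem _ hq, ?_⟩
      · rw [ec.injective.map_swap, e2, Equiv.swap_apply_self]
      · rw [ec.injective.map_swap, e3, Equiv.swap_apply_self]
      · simpa using hb
    · rintro ⟨k, p, q, e1, rfl, rfl, hp, hq, hb⟩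
      obtain ⟨p', hp', rfl⟩ := Finset.mem_image.1 hp
      obtain ⟨q', hq', rfl⟩ := Finset.mem_image.1 hq
      refine ⟨k, p', q', e1, ?_, ?_, hp', hq', by simpa using hb⟩
      · rw [← ec.injective.map_swap, Equiv.swap_apply_self]
      · rw [← ec.injective.map_swap, Equiv.swap_apply_self]

theorem mkP_anon (F : VotingMethod C V) (hF : F.dom = {P : Profile C V | P.cands.card ≤ 6})
    (han : F.Anonymous) {A : Finset (Fin 6)} {hA} (τ : Equiv.Perm Idx) : ∀ {b h0 h1 h2},
    F.winners (mkP ev ec A hA (fun k => b (τ k)) (fun k => h0 _) (fun k => h1 _)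
        (fun k => h2 _)) = F.winners (mkP ev ec A hA b h0 h1 h2) := by
  have hd : ∀ {A hA b h0 h1 h2}, mkP ev ec A hA b h0 h1 h2 ∈ F.dom := by
    intro A hA b h0 h1 h2
    rw [hF]
    change (A.map ec).card ≤ 6
    rw [Finset.card_map]
    simpa using Finset.card_le_univ A
  induction τ using Equiv.Perm.swap_induction_on with
  | one => intros; rfl
  | swap_mul g x y hxy ih =>
    intro b h0 h1 h2
    have := han (mkP ev ec A hA b h0 h1 h2) hd (ev x) (ev y)
    rw [mkP_swapVoters] at this
    rw [← this hd]
    exact ih (b := fun k => b (Equiv.swap x y k))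

/-- The profile of a tournament restricted to `A`. -/
def PT (T : Fin 6 → Fin 6 → Bool) (hT : IsT T) (A : Finset (Fin 6)) (hA : A.Nonempty) :
    Profile C V :=
  mkP ev ec A hA (bal T) (bal_irrefl hT) (bal_trans hT) (bal_total hT)

/-- Induced tournament solution. -/
def fT (F : VotingMethod C V) (T : Fin 6 → Fin 6 → Bool) (A : Finset (Fin 6)) :
    Finset (Fin 6) :=
  if h : IsT T ∧ A.Nonempty then
    Finset.univ.filter (fun p => ec p ∈ F.winners (PT ev ec T h.1 A h.2)) else ∅

variable {F : VotingMethod C V} (hF : F.dom = {P : Profile C V | P.cands.card ≤ 6})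

include hF

theorem PT_dom {T hT A hA} : PT ev ec T hT A hA ∈ F.dom := by
  rw [hF]
  change (A.map ec).card ≤ 6
  rw [Finset.card_map]
  simpa using Finset.card_le_univ A

theorem fT_map {T A} (hT : IsT T) (hA : A.Nonempty) :
    (fT ev ec F T A).map ec = F.winners (PT ev ec T hT A hA) := by
  ext x
  rw [fT, dif_pos ⟨hT, hA⟩]
  simp only [Finset.mem_map, Finset.mem_filter, Finset.mem_univ, true_and]
  constructor
  · rintro ⟨p, hp, rfl⟩; exact hp
  · intro hx
    obtain ⟨p, hp, rfl⟩ := Finset.mem_map.1 (F.winners_sub _ (PT_dom ev ec hF) hx)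
    exact ⟨p, hx, rfl⟩

theorem fT_mem {T A} (hT : IsT T) (hA : A.Nonempty) (p : Fin 6) :
    p ∈ fT ev ec F T A ↔ ec p ∈ F.winners (PT ev ec T hT A hA) := by
  rw [← fT_map ev ec hF hT hA, Finset.mem_map']

theorem fT_card {T A} (hT : IsT T) (hA : A.Nonempty) :
    (fT ev ec F T A).card = (F.winners (PT ev ec T hT A hA)).card := by
  rw [← fT_map ev ec hF hT hA, Finset.card_map]

theorem fT_sub {T A} (hT : IsT T) (hA : A.Nonempty) : fT ev ec F T A ⊆ A := by
  intro p hp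
  rw [fT_mem ev ec hF hT hA] at hp
  exact (Finset.mem_map' ec).1 (F.winners_sub _ (PT_dom ev ec hF) hp)

theorem fT_ne {T A} (hT : IsT T) (hA : A.Nonempty) : (fT ev ec F T A).Nonempty := by
  have := F.winners_nonempty _ (PT_dom ev ec hF (hT := hT) (hA := hA))
  rw [← fT_map ev ec hF hT hA] at this
  exact Finset.map_nonempty.1 this

theorem fT_congr {T T' A} (hT : IsT T) (hT' : IsT T') (hA : A.Nonempty)
    (h : ∀ x ∈ A, ∀ y ∈ A, T' x y = T x y) : fT ev ec F T' A = fT ev ec F T A := by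
  ext p
  rw [fT_mem ev ec hF hT hA, fT_mem ev ec hF hT' hA]
  have : PT ev ec T' hT' A hA = PT ev ec T hT A hA := by
    refine mkP_congr ev ec rfl ?_
    intro i p hp q hq
    unfold bal
    rw [h p hp q hq]
  rw [this]

omit hF in
theorem isT_comp {T} (hT : IsT T) (π : Equiv.Perm (Fin 6)) :
    IsT (fun x y => T (π x) (π y)) := by
  intro p q
  have := hT (π p) (π q)
  simpa using this

theorem fT_swap (han : F.Anonymous) (hne : F.Neutral) {T A} (hT : IsT T) (hA : A.Nonempty)
    (a b : Fin 6) :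
    fT ev ec F (fun x y => T (Equiv.swap a b x) (Equiv.swap a b y)) (A.image (Equiv.swap a b))
      = (fT ev ec F T A).image (Equiv.swap a b) := by
  have hT' := isT_comp hT (Equiv.swap a b)
  have key : F.winners (PT ev ec _ hT' (A.image (Equiv.swap a b)) (hA.image _)) =
      (F.winners (PT ev ec T hT A hA)).image (Equiv.swap (ec a) (ec b)) := by
    have h1 := hne (PT ev ec T hT A hA) (PT_dom ev ec hF) (ec a) (ec b)
    unfold PT at h1 ⊢
    rw [mkP_swapCands] at h1
    rw [← h1]
    · let τ : Equiv.Perm Idx :=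
        Equiv.prodCongr (Equiv.mulRight (Equiv.swap a b)) (Equiv.refl Bool)
      rw [← mkP_anon ev ec F hF han τ]
      congr 1
    · rw [hF]
      change (Finset.map ec _).card ≤ 6
      rw [Finset.card_map]
      simpa using Finset.card_le_univ (A.image (Equiv.swap a b))
  ext p
  rw [fT_mem ev ec hF hT' (hA.image _), key, ← fT_map ev ec hF hT hA]
  simp only [Finset.mem_image, Finset.mem_map]
  constructor
  · rintro ⟨_, ⟨k, hk, rfl⟩, h⟩
    rw [← ec.injective.map_swap] at h
    exact ⟨k, hk, ec.injective h⟩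
  · rintro ⟨k, hk, rfl⟩
    exact ⟨_, ⟨k, hk, rfl⟩, (ec.injective.map_swap _ _ _).symm⟩

theorem fT_perm (han : F.Anonymous) (hne : F.Neutral) (π : Equiv.Perm (Fin 6)) :
    ∀ {T A}, IsT T → A.Nonempty →
    fT ev ec F (fun x y => T (π.symm x) (π.symm y)) (A.image π) = (fT ev ec F T A).image π := by
  induction π using Equiv.Perm.swap_induction_on with
  | one =>
    intro T A hT hA
    have e : ∀ S : Finset (Fin 6), S.image (⇑(1 : Equiv.Perm (Fin 6))) = S := by
      intro S; simp
    rw [e, e]; rfl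
  | swap_mul g x y hxy ih =>
    intro T A hT hA
    have e : ∀ S : Finset (Fin 6), S.image (⇑(Equiv.swap x y * g)) =
        (S.image g).image (Equiv.swap x y) := by
      intro S; rw [Finset.image_image]; rfl
    rw [e, e, ← ih hT hA, ← fT_swap ev ec hF han hne (isT_comp hT g.symm) (hA.image _)]
    rfl

theorem fT_tr (han : F.Anonymous) (hne : F.Neutral) (T T' A) (π : Equiv.Perm (Fin 6))
    (hT : IsT T) (hT' : IsT T') (hA : A.Nonempty)
    (h : ∀ x ∈ A, ∀ y ∈ A, T' (π x) (π y) = T x y) :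
    fT ev ec F T' (A.image π) = (fT ev ec F T A).image π := by
  rw [← fT_perm ev ec hF han hne π hT hA]
  refine fT_congr ev ec hF (isT_comp hT π.symm) hT' (hA.image _) ?_
  intro x hx y hy
  obtain ⟨x', hx', rfl⟩ := Finset.mem_image.1 hx
  obtain ⟨y', hy', rfl⟩ := Finset.mem_image.1 hy
  simpa using h x' hx' y' hy'

omit hF in
theorem bal_flip {T} (hT : IsT T) (σ : Equiv.Perm (Fin 6)) (b : Bool) (x y : Fin 6)
    (hxy : T x y = true) (h : bal T (σ, b) y x) : bal T (σ, !b) x y := by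
  have h1 : T y x = false := by
    have := hT x y
    cases hh : T y x <;> simp_all
  unfold bal at *
  cases b <;> by_cases hx : σ x < 2 <;> by_cases hy : σ y < 2 <;> simp_all

theorem fT_pair_card (hq : F.BinaryQuasiResolute) {T} (hT : IsT T) {x y : Fin 6}
    (hxy : T x y = true) : (fT ev ec F T {x, y}).card = 1 := by
  have hne : x ≠ y := hT.ne hxy
  have hA : ({x, y} : Finset (Fin 6)).Nonempty := ⟨x, by simp⟩
  rw [fT_card ev ec hF hT hA]
  have hc : (PT ev ec T hT {x, y} hA : Profile C V).cands.card = 2 := by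
    change (Finset.map ec _).card = 2
    rw [Finset.card_map, Finset.card_pair hne]
  refine hq _ (PT_dom ev ec hF) hc ?_
  set P : Profile C V := PT ev ec T hT {x, y} hA with hP
  have hball : ∀ i p q, p ∈ ({x, y} : Finset (Fin 6)) → q ∈ ({x, y} : Finset (Fin 6)) →
      (P.ballot (ev i) (ec p) (ec q) ↔ bal T i p q) := by
    intro i p q hp hq
    constructor
    · rintro ⟨i', p', q', e1, e2, e3, -, -, hb⟩
      rw [ev.injective e1, ec.injective e2, ec.injective e3] at hb
      exact hb
    · intro hb
      exact ⟨i, p, q, rfl, rfl, rfl, hp, hq, hb⟩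
  have hcount : ∀ p q, p ∈ ({x, y} : Finset (Fin 6)) → q ∈ ({x, y} : Finset (Fin 6)) →
      (P.voters.filter (fun v => P.ballot v (ec p) (ec q))).card =
        (UI.filter (fun i => bal T i p q)).card := by
    intro p q hp hq
    have : P.voters.filter (fun v => P.ballot v (ec p) (ec q)) =
        (UI.filter (fun i => bal T i p q)).map ev := by
      ext v
      simp only [Finset.mem_filter, Finset.mem_map, mem_UI, true_and]
      constructor
      · rintro ⟨hv, hb⟩
        obtain ⟨i, -, rfl⟩ := Finset.mem_map.1 hv
        exact ⟨i, (hball i p q hp hq).1 hb, rfl⟩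
      · rintro ⟨i, hb, rfl⟩
        exact ⟨Finset.mem_map_of_mem _ (mem_UI _), (hball i p q hp hq).2 hb⟩
    rw [this, Finset.card_map]
  have hlt : (UI.filter (fun i => bal T i y x)).card <
      (UI.filter (fun i => bal T i x y)).card := by
    let g : Idx ↪ Idx := ⟨fun i => (i.1, !i.2), by
      rintro ⟨a, b⟩ ⟨a', b'⟩ h
      simpa using h⟩
    rw [← Finset.card_map g]
    apply Finset.card_lt_card
    rw [Finset.ssubset_iff_of_subset]
    · obtain ⟨π, h0, h1⟩ : ∃ π : Equiv.Perm (Fin 6), π x = 0 ∧ π y = 1 := by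
        refine ⟨Equiv.swap (Equiv.swap x 0 y) 1 * Equiv.swap x 0, ?_⟩
        have gen : ∀ x y : Fin 6, x ≠ y →
            (Equiv.swap (Equiv.swap x 0 y) 1 * Equiv.swap x 0) x = 0 ∧
            (Equiv.swap (Equiv.swap x 0 y) 1 * Equiv.swap x 0) y = 1 := by decide
        exact gen x y hne
      refine ⟨(π, true), ?_, ?_⟩
      · simp [bal, h0, h1, hxy, mem_UI]
      · intro hm
        obtain ⟨⟨σ, b⟩, hi, hg⟩ := Finset.mem_map.1 hm
        have e : σ = π := congrArg Prod.fst hg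
        subst e
        have hi2 := (Finset.mem_filter.1 hi).2
        simp [bal, h0, h1, hT.asymm hxy] at hi2
    · intro i hi0
      obtain ⟨⟨σ, b⟩, hi, rfl⟩ := Finset.mem_map.1 hi0
      simp only [Finset.mem_filter, mem_UI, true_and] at hi ⊢
      exact bal_flip hT σ b x y hxy hi
  have hx : x ∈ ({x, y} : Finset (Fin 6)) := by simp
  have hy : y ∈ ({x, y} : Finset (Fin 6)) := by simp
  have m1 := hcount x y hx hy
  have m2 := hcount y x hy hx
  intro u hu v hv huv
  obtain ⟨p, hp, rfl⟩ := Finset.mem_map.1 hu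
  obtain ⟨q, hq', rfl⟩ := Finset.mem_map.1 hv
  have hpq : p ≠ q := fun h => huv (by rw [h])
  unfold Profile.margin
  simp only [Finset.mem_insert, Finset.mem_singleton] at hp hq'
  rcases hp with rfl | rfl <;> rcases hq' with rfl | rfl
  · exact absurd rfl hpq
  · rw [m1, m2]; omega
  · rw [m1, m2]; omega
  · exact absurd rfl hpq

theorem fT_ga (hg : F.BinaryGamma) (hal : F.AlphaResolute) (T A) (x y : Fin 6) (hT : IsT T)
    (hx : x ∈ A) (hy : y ∈ A) (hne : x ≠ y) (hp : fT ev ec F T {x, y} = {x})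
    (hm : x ∈ fT ev ec F T (A.erase y)) :
    x ∈ fT ev ec F T A ∧ (fT ev ec F T A).card ≤ (fT ev ec F T (A.erase y)).card := by
  have hA : A.Nonempty := ⟨x, hx⟩
  have hE : (A.erase y).Nonempty := ⟨x, Finset.mem_erase.2 ⟨hne, hx⟩⟩
  have hxy : ({x, y} : Finset (Fin 6)).Nonempty := ⟨x, by simp⟩
  have hx' : ec x ∈ (PT ev ec T hT A hA : Profile C V).cands := Finset.mem_map_of_mem _ hx
  have hy' : ec y ∈ (PT ev ec T hT A hA : Profile C V).cands := Finset.mem_map_of_mem _ hy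
  have hne' : ec x ≠ ec y := fun h => hne (ec.injective h)
  have hn : ((PT ev ec T hT A hA : Profile C V).cands.erase (ec y)).Nonempty :=
    ⟨ec x, Finset.mem_erase.2 ⟨hne', hx'⟩⟩
  have e1 : (PT ev ec T hT A hA : Profile C V).minus (ec y) hn = PT ev ec T hT (A.erase y) hE := by
    refine mkP_restrict ev ec (Finset.erase_subset _ _) _ ?_ _ _
    exact (Finset.map_erase ec A y).symm
  have e2 : (PT ev ec T hT A hA : Profile C V).pair (ec x) (ec y) hx' hy' =
      PT ev ec T hT {x, y} hxy := by
    refine mkP_restrict ev ec ?_ _ ?_ _ _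
    · intro z hz
      simp only [Finset.mem_insert, Finset.mem_singleton] at hz
      rcases hz with rfl | rfl <;> assumption
    · ext z; simp [eq_comm]
  have w : F.winners (PT ev ec T hT {x, y} hxy) = {ec x} := by
    rw [← fT_map ev ec hF hT hxy, hp]; simp
  have g := hg _ (PT_dom ev ec hF) _ hx' _ hy' hne' hn
  have al := hal _ (PT_dom ev ec hF) _ hx' _ hy' hne' hn
  rw [e1, e2, ← fT_mem ev ec hF hT hE, ← fT_mem ev ec hF hT hA] at g
  rw [e1, e2, ← fT_mem ev ec hF hT hE, ← fT_card ev ec hF hT hE, ← fT_card ev ec hF hT hA] at al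
  exact ⟨g (PT_dom ev ec hF) (PT_dom ev ec hF) hm w, al (PT_dom ev ec hF) (PT_dom ev ec hF) hm w⟩

theorem fT_orient (han : F.Anonymous) (hne : F.Neutral) (hq : F.BinaryQuasiResolute) :
    (∀ T, IsT T → ∀ x y, T x y = true → fT ev ec F T {x, y} = {x}) ∨
    (∀ T, IsT T → ∀ x y, T x y = true → fT ev ec F T {x, y} = {y}) := by
  have key : ∀ T, IsT T → ∀ x y, T x y = true → ∃ π : Equiv.Perm (Fin 6), π 0 = x ∧ π 1 = y ∧
      fT ev ec F T {x, y} = (fT ev ec F TA {0, 1}).image π := by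
    intro T hT x y hxy
    have hxy' : x ≠ y := hT.ne hxy
    obtain ⟨π, h0, h1⟩ : ∃ π : Equiv.Perm (Fin 6), π 0 = x ∧ π 1 = y := by
      refine ⟨Equiv.swap (Equiv.swap 0 x 1) y * Equiv.swap 0 x, ?_⟩
      have gen : ∀ x y : Fin 6, x ≠ y →
          (Equiv.swap (Equiv.swap 0 x 1) y * Equiv.swap 0 x) 0 = x ∧
          (Equiv.swap (Equiv.swap 0 x 1) y * Equiv.swap 0 x) 1 = y := by decide
      exact gen x y hxy'
    refine ⟨π, h0, h1, ?_⟩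
    rw [← fT_tr ev ec hF han hne TA T {0, 1} π isT_TA hT (by decide)]
    · congr 1
      simp [Finset.image_insert, h0, h1]
    · intro a ha b hb
      simp only [Finset.mem_insert, Finset.mem_singleton] at ha hb
      rcases ha with rfl | rfl <;> rcases hb with rfl | rfl
      · rw [hT.irr]; decide
      · rw [h0, h1, hxy]; decide
      · rw [h0, h1, hT.asymm hxy]; decide
      · rw [hT.irr]; decide
  have c := fT_pair_card ev ec hF hq isT_TA (x := 0) (y := 1) (by decide)
  have s := fT_sub ev ec hF isT_TA (A := {0, 1}) (by decide)
  obtain ⟨z, hz⟩ := Finset.card_eq_one.1 c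
  rw [hz, Finset.singleton_subset_iff] at s
  simp only [Finset.mem_insert, Finset.mem_singleton] at s
  rcases s with rfl | rfl
  · left
    intro T hT x y hxy
    obtain ⟨π, h0, h1, h⟩ := key T hT x y hxy
    rw [h, hz, Finset.image_singleton, h0]
  · right
    intro T hT x y hxy
    obtain ⟨π, h0, h1, h⟩ := key T hT x y hxy
    rw [h, hz, Finset.image_singleton, h1]

end

theorem isT_rev {T} (hT : IsT T) : IsT (fun x y => T y x) := by
  intro p q
  have h1 := hT q p
  have h2 := hT p q
  by_cases h : p = q
  · subst h; simpa using h1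
  · simp_all

end SixCand

/-- There is no voting method whose domain is the set of all profiles
with at most 6 candidates that satisfies anonymity, neutrality, binary
quasi-resoluteness, binary γ, and α-resoluteness. -/
theorem no_voting_method_six_candidates (C V : Type) [Infinite C] [Infinite V] :
    ¬ ∃ F : VotingMethod C V,
      F.dom = {P : Profile C V | P.cands.card ≤ 6} ∧
      F.Anonymous ∧ F.Neutral ∧ F.BinaryQuasiResolute ∧ F.BinaryGamma ∧
      F.AlphaResolute := by
  rintro ⟨F, hF, han, hne, hq, hg, hal⟩
  let ev : SixCand.Idx ↪ V := (Fintype.equivFin SixCand.Idx).toEmbedding.trans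
    (Fin.valEmbedding.trans (Infinite.natEmbedding V))
  let ec : Fin 6 ↪ C := Fin.valEmbedding.trans (Infinite.natEmbedding C)
  rcases SixCand.fT_orient ev ec hF han hne hq with ho | ho
  · refine SixCand.core (SixCand.fT ev ec F) (fun T A => SixCand.fT_sub ev ec hF)
      (fun T A => SixCand.fT_ne ev ec hF) (SixCand.fT_tr ev ec hF han hne) ?_
    intro T A x y hT hx hy hxy ht hm
    exact SixCand.fT_ga ev ec hF hg hal T A x y hT hx hy hxy (ho T hT x y ht) hm
  · refine SixCand.core (fun T A => SixCand.fT ev ec F (fun x y => T y x) A)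
      (fun T A h => SixCand.fT_sub ev ec hF (SixCand.isT_rev h))
      (fun T A h => SixCand.fT_ne ev ec hF (SixCand.isT_rev h))
      (fun T T' A π h h' hA hh => SixCand.fT_tr ev ec hF han hne _ _ A π (SixCand.isT_rev h)
        (SixCand.isT_rev h') hA (fun x hx y hy => hh y hy x hx)) ?_
    intro T A x y hT hx hy hxy ht hm
    refine SixCand.fT_ga ev ec hF hg hal _ A x y (SixCand.isT_rev hT) hx hy hxy ?_ hm
    have := ho _ (SixCand.isT_rev hT) y x ht
    rwa [Finset.pair_comm] at this
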